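/- arXiv:1909.10062 — 10 statements merged into one kernel-verified Lean document; each statement's English description precedes it below -/
import Mathlib

section
/- Suppose θ̂ is the unique optimal solution of the primal LP, i.e. θ̂ ∈ 𝓕, and every θ ∈ 𝓕 with θ ≠ θ̂ satisfies θ̂₀ < θ₀. Let B := {j : Y_j = (Wθ̂)_j} be the set of binding constraints, and assume the solution is non-degenerate, i.e. the rows {W_j : j ∈ B} are linearly independent in ℝ^{p+1}. Then B has exactly p+1 elements (so that W_B is a square invertible matrix). (This is the paper's Lemma 4.) -/
open Matrix

/-- Moving a feasible point along a direction annihilated by all binding rows preserves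
feasibility for small steps. -/
theorem eventually_feasible_add_smul {m n : Type*} [Finite m] [Fintype n]
    (W : Matrix m n ℝ) (Y : m → ℝ) (θ v : n → ℝ) (hfeas : ∀ j, Y j ≤ (W *ᵥ θ) j)
    (hv : ∀ j, Y j = (W *ᵥ θ) j → (W *ᵥ v) j = 0) :
    ∀ᶠ t : ℝ in nhds 0, ∀ j, Y j ≤ (W *ᵥ (θ + t • v)) j := by
  rw [Filter.eventually_all]
  intro j
  have h_expand (t : ℝ) : (W *ᵥ (θ + t • v)) j = (W *ᵥ θ) j + t * (W *ᵥ v) j := by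
    simp [mulVec_add, mulVec_smul]
  simp only [h_expand]
  rcases (hfeas j).eq_or_lt with h | h
  · simp [hv j h, hfeas j]
  · have hcont : Continuous fun t : ℝ => (W *ᵥ θ) j + t * (W *ᵥ v) j := by fun_prop
    have hlim := hcont.tendsto 0
    simp only [zero_mul, add_zero] at hlim
    exact (hlim.eventually_const_lt h).mono fun _ ht => ht.le

/-- Lemma 4: with a unique non-degenerate primal solution, the binding set has
exactly `p + 1` elements. -/
theorem stmt_2
    (k p : ℕ) (hk : 0 < k)
    (W : Matrix (Fin k) (Fin (p + 1)) ℝ) (Y : Fin k → ℝ)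
    (θhat : Fin (p + 1) → ℝ)
    (hfeas : ∀ j, Y j ≤ W.mulVec θhat j)
    (hunique : ∀ θ : Fin (p + 1) → ℝ, (∀ j, Y j ≤ W.mulVec θ j) → θ ≠ θhat → θhat 0 < θ 0)
    (B : Set (Fin k)) (hB : B = {j | Y j = W.mulVec θhat j})
    (hindep : LinearIndependent ℝ fun j : B => W (j : Fin k)) :
    B.ncard = p + 1 := by
  have hfin : Fintype B := Fintype.ofFinite B
  rw [← Nat.card_coe_set_eq, Nat.card_eq_fintype_card]
  refine le_antisymm (by simpa using hindep.fintype_card_le_finrank) ?_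
  by_contra! hlt
  have hker : (Matrix.toLin' (W.submatrix ((↑) : B → Fin k) id)).ker ≠ ⊥ :=
    LinearMap.ker_ne_bot_of_finrank_lt (by simpa using hlt)
  obtain ⟨v, hv, hv0⟩ := Submodule.exists_mem_ne_zero_of_ne_bot hker
  have hbind (j : Fin k) (hj : Y j = (W *ᵥ θhat) j) : (W *ᵥ v) j = 0 :=
    congrFun (LinearMap.mem_ker.mp hv) ⟨j, hB ▸ hj⟩
  have hpos := eventually_feasible_add_smul W Y θhat v hfeas hbind
  have hneg := eventually_feasible_add_smul W Y θhat (-v) hfeas fun j hj => by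
    simp [mulVec_neg, hbind j hj]
  obtain ⟨t, ⟨hp, hn⟩, ht⟩ :=
    (((hpos.and hneg).filter_mono nhdsWithin_le_nhds).and
      (self_mem_nhdsWithin (s := Set.Ioi (0 : ℝ)))).exists
  have ht0 : t ≠ 0 := ne_of_gt ht
  have h1 := hunique _ hp (by simp [ht0, hv0])
  have h2 := hunique _ hn (by simp [ht0, hv0])
  simp only [Pi.add_apply, Pi.smul_apply, Pi.neg_apply, smul_eq_mul] at h1 h2
  linarith
end

section
/- Let B be a subset of {1,…,k} with |B| = p+1 such that W_B is invertible and the vector (W_Bᵀ)⁻¹e₁ has all coordinates nonnegative. Define θ_B := W_B⁻¹ Y_B. Then there exists an optimal solution θ of the primal LP satisfying Y_j = (Wθ)_j for all j ∈ B if and only if Y_j ≤ (W θ_B)_j for every j ∈ {1,…,k}. (This is the paper's Lemma 5, with the dual-feasibility condition (W_Bᵀ)⁻¹e₁ ≥ 0 made explicit.) -/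
open Matrix

/-- Lemma 5: existence of an optimal primal solution with the moments `B` binding is
equivalent to feasibility of `θ_B = W_B⁻¹ Y_B`. -/
theorem stmt_3
    (k p : ℕ) (hk : 0 < k)
    (W : Matrix (Fin k) (Fin (p + 1)) ℝ) (Y : Fin k → ℝ)
    (b : Fin (p + 1) → Fin k) (hb : Function.Injective b)
    (WB : Matrix (Fin (p + 1)) (Fin (p + 1)) ℝ) (hWBdef : WB = W.submatrix b id)
    (hWB : IsUnit WB.det)
    (e₁ : Fin (p + 1) → ℝ) (he₁ : e₁ = Pi.single 0 1)
    (hdual : ∀ i, 0 ≤ Matrix.mulVec ((WB.transpose)⁻¹) e₁ i)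
    (θB : Fin (p + 1) → ℝ) (hθB : θB = Matrix.mulVec (WB⁻¹) fun i => Y (b i)) :
    (∃ θ : Fin (p + 1) → ℝ,
        (∀ j, Y j ≤ W.mulVec θ j) ∧
        (∀ θ' : Fin (p + 1) → ℝ, (∀ j, Y j ≤ W.mulVec θ' j) → θ 0 ≤ θ' 0) ∧
        (∀ i, Y (b i) = W.mulVec θ (b i))) ↔
      ∀ j, Y j ≤ W.mulVec θB j := by
  have hmul : ∀ θ : Fin (p + 1) → ℝ, ∀ i, (WB *ᵥ θ) i = (W *ᵥ θ) (b i) := by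
    intro θ i
    subst hWBdef
    rfl
  have hunit_transpose : IsUnit WBᵀ.det := by rwa [Matrix.det_transpose]
  have hfirst : ∀ θ : Fin (p + 1) → ℝ, θ 0 = (WBᵀ⁻¹ *ᵥ e₁) ⬝ᵥ (WB *ᵥ θ) := by
    intro θ
    rw [Matrix.dotProduct_mulVec, ← Matrix.mulVec_transpose, Matrix.mulVec_mulVec,
      Matrix.mul_nonsing_inv _ hunit_transpose, Matrix.one_mulVec, he₁, single_one_dotProduct]
  have hbind : WB *ᵥ θB = fun i => Y (b i) := by
    rw [hθB, Matrix.mulVec_mulVec, Matrix.mul_nonsing_inv _ hWB, Matrix.one_mulVec]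
  constructor
  · rintro ⟨θ, hfeas, -, hθ⟩
    have hWBθ : WB *ᵥ θ = fun i => Y (b i) := by
      funext i
      rw [hmul, ← hθ]
    have hθ_eq : θ = θB := by
      rw [hθB, ← hWBθ, Matrix.mulVec_mulVec, Matrix.nonsing_inv_mul _ hWB, Matrix.one_mulVec]
    rwa [← hθ_eq]
  · intro hfeas
    refine ⟨θB, hfeas, fun θ' hθ' => ?_, fun i => ?_⟩
    · rw [hfirst θB, hfirst θ', hbind]
      refine Finset.sum_le_sum fun i _ => mul_le_mul_of_nonneg_left ?_ (hdual i)
      rw [hmul]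
      exact hθ' (b i)
    · rw [← hmul, hbind]
end

section
/- Let B ⊆ {1,…,k} with |B| = p+1 and W_B invertible, let Σ be a symmetric positive semidefinite k×k matrix, let γ ∈ ℝ^k be the vector with γ_j = 0 for j ∉ B and whose B-subvector equals (W_Bᵀ)⁻¹e₁, and assume γᵀΣγ > 0. Let M_B be the (p+1)×k selection matrix with M_B y = y_B, set Λ := I_k − W W_B⁻¹ M_B, Δ := (1/(γᵀΣγ))·Σγ, and S(y) := y − Δ·(γᵀy). Then for every y ∈ ℝ^k, the condition y − W W_B⁻¹ y_B ≤ 0 (componentwise) holds if and only if all three of the following hold: (i) for every j with (ΛΔ)_j < 0, γᵀy ≥ −(Λ S(y))_j/(ΛΔ)_j; (ii) for every j with (ΛΔ)_j > 0, γᵀy ≤ −(Λ S(y))_j/(ΛΔ)_j; (iii) for every j with (ΛΔ)_j = 0, (Λ S(y))_j ≤ 0. (This is the paper's Lemma 6, the polyhedral characterization 𝒱^lo(S) ≤ γᵀy ≤ 𝒱^up(S) and 𝒱⁰(S) ≥ 0, stated componentwise.) -/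
open Matrix

/-- Solving the affine inequality `s j + t * a j ≤ 0` for `t`, by the sign of the slope `a j`. -/
theorem forall_add_mul_nonpos_iff {ι 𝕜 : Type*} [Field 𝕜] [LinearOrder 𝕜] [IsStrictOrderedRing 𝕜]
    (s a : ι → 𝕜) (t : 𝕜) :
    (∀ j, s j + t * a j ≤ 0) ↔
      (∀ j, a j < 0 → -(s j) / a j ≤ t) ∧ (∀ j, 0 < a j → t ≤ -(s j) / a j) ∧
        (∀ j, a j = 0 → s j ≤ 0) := by
  constructor
  · intro h
    refine ⟨fun j hj => ?_, fun j hj => ?_, fun j hj => ?_⟩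
    · rw [div_le_iff_of_neg hj]
      linarith [h j]
    · rw [le_div_iff₀ hj]
      linarith [h j]
    · simpa [hj] using h j
  · rintro ⟨hneg, hpos, hzero⟩ j
    rcases lt_trichotomy (a j) 0 with hj | hj | hj
    · have := (div_le_iff_of_neg hj).1 (hneg j hj)
      linarith
    · simpa [hj] using hzero j hj
    · have := (le_div_iff₀ hj).1 (hpos j hj)
      linarith

/-- Lemma 6: polyhedral characterization of the event that there is a solution with
the moments `B` binding. -/
theorem stmt_4
    (k p : ℕ) (hk : 0 < k)
    (W : Matrix (Fin k) (Fin (p + 1)) ℝ)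
    (b : Fin (p + 1) → Fin k) (hb : Function.Injective b)
    (WB : Matrix (Fin (p + 1)) (Fin (p + 1)) ℝ) (hWBdef : WB = W.submatrix b id)
    (hWB : IsUnit WB.det)
    (Sig : Matrix (Fin k) (Fin k) ℝ) (hSig : Sig.PosSemidef)
    (e₁ : Fin (p + 1) → ℝ) (he₁ : e₁ = Pi.single 0 1)
    (γ : Fin k → ℝ)
    (hγ0 : ∀ j, j ∉ Set.range b → γ j = 0)
    (hγB : ∀ i, γ (b i) = Matrix.mulVec ((WB.transpose)⁻¹) e₁ i)
    (hvar : 0 < γ ⬝ᵥ Sig.mulVec γ)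
    (MB : Matrix (Fin (p + 1)) (Fin k) ℝ)
    (hMB : ∀ y : Fin k → ℝ, MB.mulVec y = fun i => y (b i))
    (Lam : Matrix (Fin k) (Fin k) ℝ)
    (hLam : Lam = 1 - W * WB⁻¹ * MB)
    (Δ : Fin k → ℝ) (hΔ : Δ = (1 / (γ ⬝ᵥ Sig.mulVec γ)) • Sig.mulVec γ)
    (S : (Fin k → ℝ) → Fin k → ℝ)
    (hS : ∀ y, S y = y - (γ ⬝ᵥ y) • Δ) :
    ∀ y : Fin k → ℝ,
      (∀ j, y j - W.mulVec (Matrix.mulVec (WB⁻¹) fun i => y (b i)) j ≤ 0) ↔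
        ((∀ j, Lam.mulVec Δ j < 0 →
            -(Lam.mulVec (S y) j) / Lam.mulVec Δ j ≤ γ ⬝ᵥ y) ∧
          (∀ j, 0 < Lam.mulVec Δ j →
            γ ⬝ᵥ y ≤ -(Lam.mulVec (S y) j) / Lam.mulVec Δ j) ∧
          (∀ j, Lam.mulVec Δ j = 0 → Lam.mulVec (S y) j ≤ 0)) := by
  intro y
  rw [← forall_add_mul_nonpos_iff (Lam.mulVec (S y)) (Lam.mulVec Δ) (γ ⬝ᵥ y)]
  refine forall_congr' fun j => ?_
  have hresidual : Lam.mulVec y j =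
      y j - W.mulVec (Matrix.mulVec (WB⁻¹) fun i => y (b i)) j := by
    rw [hLam, sub_mulVec, one_mulVec, ← mulVec_mulVec, ← mulVec_mulVec, hMB, Pi.sub_apply]
  have hdecomp : Lam.mulVec (S y) j + (γ ⬝ᵥ y) * Lam.mulVec Δ j = Lam.mulVec y j := by
    rw [hS, mulVec_sub, mulVec_smul, Pi.sub_apply, Pi.smul_apply, smul_eq_mul, sub_add_cancel]
  rw [hdecomp, hresidual]
end

section
/- Suppose W_{j,1} > 0 for every j (the first column of W is strictly positive) and the primal objective is bounded below on the feasible set, i.e. BddBelow {θ₀ : θ ∈ 𝓕}. Then there exists a dual feasible vector γ* (γ* ≥ 0 componentwise and Wᵀγ* = e₁) such that γ*ᵀY = sInf{θ₀ : θ ∈ 𝓕} and γᵀY ≤ γ*ᵀY for every dual feasible γ. (This is the paper's Lemma A.1: when the primal value η̂ is finite, it equals the attained value of the dual program max γᵀY subject to γ ≥ 0, Wᵀγ = e₁.) -/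
open Matrix

/-- Farkas' lemma for finitely many linear functionals on a vector space: a functional that is
nonnegative wherever all the `a i` are is a nonnegative combination of the `a i`. -/
theorem exists_nonneg_sum_smul_eq_of_forall_nonneg {V : Type*} [AddCommGroup V] [Module ℝ V]
    (m : ℕ) (a : Fin m → Module.Dual ℝ V) (b : Module.Dual ℝ V)
    (h : ∀ x, (∀ i, 0 ≤ a i x) → 0 ≤ b x) :
    ∃ c : Fin m → ℝ, (∀ i, 0 ≤ c i) ∧ ∀ x, b x = ∑ i, c i * a i x := by
  induction m generalizing b with
  | zero =>
    refine ⟨0, fun i => i.elim0, fun x => ?_⟩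
    have h1 := h x fun i => i.elim0
    have h2 := h (-x) fun i => i.elim0
    rw [map_neg] at h2
    simp only [Finset.univ_eq_empty, Finset.sum_empty]
    linarith
  | succ m ih =>
    by_cases hb : ∀ x, (∀ i : Fin m, 0 ≤ a i.succ x) → 0 ≤ b x
    · obtain ⟨c, hc, hcb⟩ := ih (fun i => a i.succ) b hb
      refine ⟨Fin.cons 0 c, Fin.cases (by simp) (by simpa using hc), fun x => ?_⟩
      simp [Fin.sum_univ_succ, hcb x]
    · push Not at hb
      obtain ⟨y, hy, hby⟩ := hb
      have hay : a 0 y < 0 := by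
        by_contra! h0
        exact hby.not_ge (h y (Fin.cases h0 hy))
      -- Rescale so that `a 0` takes the value `-1`, then project along `z` onto its kernel.
      obtain ⟨z, hz, hbz, haz⟩ : ∃ z, (∀ i : Fin m, 0 ≤ a i.succ z) ∧ b z < 0 ∧ a 0 z = -1 := by
        have hpos : 0 < (-(a 0 y))⁻¹ := inv_pos.mpr (neg_pos.mpr hay)
        refine ⟨(-(a 0 y))⁻¹ • y, fun i => ?_, ?_, ?_⟩
        · simpa only [map_smul, smul_eq_mul] using mul_nonneg hpos.le (hy i)
        · simpa only [map_smul, smul_eq_mul] using mul_neg_of_pos_of_neg hpos hby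
        · rw [map_smul, smul_eq_mul]
          field_simp [hay.ne]
      obtain ⟨c, hc, hcb⟩ := ih (fun i => a i.succ + a i.succ z • a 0) (b + b z • a 0) (by
        intro x hx
        have hproj := h (x + a 0 x • z) (Fin.cases (by simp [haz]) fun i => by
          simpa [mul_comm] using hx i)
        simpa [mul_comm] using hproj)
      refine ⟨Fin.cons (∑ i, c i * a i.succ z - b z) c, ?_, fun x => ?_⟩
      · refine Fin.cases ?_ (by simpa using hc)
        have := Finset.sum_nonneg fun i (_ : i ∈ Finset.univ) => mul_nonneg (hc i) (hz i)
        simp only [Fin.cons_zero]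
        linarith
      · have hx := hcb x
        simp only [LinearMap.add_apply, LinearMap.smul_apply, smul_eq_mul, mul_add,
          Finset.sum_add_distrib, ← mul_assoc, ← Finset.sum_mul] at hx
        simp only [Fin.sum_univ_succ, Fin.cons_zero, Fin.cons_succ]
        linarith

/-- A system `Y ≤ Wθ` is solvable when the first column of `W` is positive. -/
theorem exists_le_mulVec_of_pos_col {k p : ℕ} (W : Matrix (Fin k) (Fin (p + 1)) ℝ)
    (Y : Fin k → ℝ) (hW : ∀ j, 0 < W j 0) : ∃ θ, ∀ j, Y j ≤ (W *ᵥ θ) j := by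
  refine ⟨Pi.single 0 (∑ i, |Y i / W i 0|), fun j => ?_⟩
  have hj : Y j / W j 0 ≤ ∑ i, |Y i / W i 0| :=
    (le_abs_self _).trans (Finset.single_le_sum
      (f := fun i => |Y i / W i 0|) (fun i _ => abs_nonneg _) (Finset.mem_univ j))
  rw [div_le_iff₀ (hW j)] at hj
  simpa [Matrix.mulVec_single, mul_comm] using hj

/-- Weak duality. -/
theorem dotProduct_le_of_dual_feasible {k p : ℕ} {W : Matrix (Fin k) (Fin (p + 1)) ℝ}
    {Y γ : Fin k → ℝ} {θ : Fin (p + 1) → ℝ} (hγ : ∀ j, 0 ≤ γ j)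
    (hWγ : Wᵀ *ᵥ γ = Pi.single 0 1) (hθ : ∀ j, Y j ≤ (W *ᵥ θ) j) : γ ⬝ᵥ Y ≤ θ 0 :=
  calc
    γ ⬝ᵥ Y ≤ γ ⬝ᵥ W *ᵥ θ := Finset.sum_le_sum fun j _ => mul_le_mul_of_nonneg_left (hθ j) (hγ j)
    _ = θ 0 := by
      rw [Matrix.dotProduct_mulVec, ← Matrix.mulVec_transpose, hWγ, single_one_dotProduct]

/-- If `v` bounds the objective below on a nonempty feasible set, then the homogenized bound
holds on the homogenized feasible cone. -/
theorem mul_le_of_homogenized_feasible {k p : ℕ} {W : Matrix (Fin k) (Fin (p + 1)) ℝ}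
    {Y : Fin k → ℝ} {v : ℝ} (hne : ∃ θ, ∀ j, Y j ≤ (W *ᵥ θ) j)
    (hv : ∀ θ, (∀ j, Y j ≤ (W *ᵥ θ) j) → v ≤ θ 0) {θ : Fin (p + 1) → ℝ} {t : ℝ} (ht : 0 ≤ t)
    (hθ : ∀ j, t * Y j ≤ (W *ᵥ θ) j) : t * v ≤ θ 0 := by
  rcases ht.eq_or_lt with rfl | ht
  · obtain ⟨θ₁, hθ₁⟩ := hne
    by_contra! hneg
    rw [zero_mul] at hneg
    have hv₁ := hv θ₁ hθ₁
    have hs : 0 ≤ (θ₁ 0 - v + 1) / -(θ 0) := div_nonneg (by linarith) (by linarith)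
    have hray := hv (θ₁ + ((θ₁ 0 - v + 1) / -(θ 0)) • θ) fun j => by
      have hj := mul_nonneg hs (by simpa using hθ j)
      simp only [Matrix.mulVec_add, Matrix.mulVec_smul, Pi.add_apply, Pi.smul_apply, smul_eq_mul]
      linarith [hθ₁ j]
    have hcancel : (θ₁ 0 - v + 1) / -(θ 0) * θ 0 = -(θ₁ 0 - v + 1) := by
      field_simp [hneg.ne]
    simp only [Pi.add_apply, Pi.smul_apply, smul_eq_mul, hcancel] at hray
    linarith
  · have hscaled := hv (t⁻¹ • θ) fun j => by
      rw [Matrix.mulVec_smul, Pi.smul_apply, smul_eq_mul, le_inv_mul_iff₀ ht]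
      exact hθ j
    rwa [Pi.smul_apply, smul_eq_mul, le_inv_mul_iff₀ ht] at hscaled

/-- A lower bound for the objective on a nonempty feasible set is matched by a dual feasible
vector. -/
theorem exists_dual_feasible_ge {k p : ℕ} {W : Matrix (Fin k) (Fin (p + 1)) ℝ}
    {Y : Fin k → ℝ} {v : ℝ} (hne : ∃ θ, ∀ j, Y j ≤ (W *ᵥ θ) j)
    (hv : ∀ θ, (∀ j, Y j ≤ (W *ᵥ θ) j) → v ≤ θ 0) :
    ∃ γ : Fin k → ℝ, (∀ j, 0 ≤ γ j) ∧ Wᵀ *ᵥ γ = Pi.single 0 1 ∧ v ≤ γ ⬝ᵥ Y := by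
  let a : Fin (k + 1) → Module.Dual ℝ ((Fin (p + 1) → ℝ) × ℝ) :=
    Fin.cons (LinearMap.snd ℝ _ ℝ) fun j =>
      LinearMap.proj j ∘ₗ W.mulVecLin ∘ₗ LinearMap.fst ℝ _ ℝ - Y j • LinearMap.snd ℝ _ ℝ
  let b : Module.Dual ℝ ((Fin (p + 1) → ℝ) × ℝ) :=
    LinearMap.proj (R := ℝ) (φ := fun _ => ℝ) 0 ∘ₗ LinearMap.fst ℝ _ ℝ - v • LinearMap.snd ℝ _ ℝ
  obtain ⟨c, hc, hcb⟩ := exists_nonneg_sum_smul_eq_of_forall_nonneg (k + 1) a b (by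
    rintro ⟨θ, t⟩ hx
    have ht : 0 ≤ t := by simpa [a] using hx 0
    have := mul_le_of_homogenized_feasible hne hv (θ := θ) ht fun j => by
      simpa [a, mul_comm] using hx j.succ
    simpa [b, mul_comm] using this)
  refine ⟨fun j => c j.succ, fun j => hc _, ?_, ?_⟩
  · ext i
    have h : (Pi.single i 1 : Fin (p + 1) → ℝ) 0 = ∑ j, c j.succ * W j i := by
      simpa [a, b, Fin.sum_univ_succ] using hcb (Pi.single i 1, 0)
    rw [Matrix.mulVec_transpose, Matrix.vecMul, dotProduct, ← h, Pi.single_comm]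
  · have h : -v = c 0 + -∑ j, c j.succ * Y j := by
      simpa [a, b, Fin.sum_univ_succ] using hcb (0, 1)
    rw [dotProduct]
    linarith [hc 0]

/-- Lemma A.1: when the primal value is finite, it equals the attained value of the
dual program `max γᵀY` subject to `γ ≥ 0`, `Wᵀγ = e₁`. -/
theorem stmt_5
    (k p : ℕ) (hk : 0 < k)
    (W : Matrix (Fin k) (Fin (p + 1)) ℝ) (Y : Fin k → ℝ)
    (e₁ : Fin (p + 1) → ℝ) (he₁ : e₁ = Pi.single 0 1)
    (hW1 : ∀ j, 0 < W j 0)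
    (hbdd : BddBelow {r : ℝ | ∃ θ : Fin (p + 1) → ℝ, (∀ j, Y j ≤ W.mulVec θ j) ∧ r = θ 0}) :
    ∃ γ : Fin k → ℝ,
      (∀ j, 0 ≤ γ j) ∧ W.transpose.mulVec γ = e₁ ∧
      γ ⬝ᵥ Y =
        sInf {r : ℝ | ∃ θ : Fin (p + 1) → ℝ, (∀ j, Y j ≤ W.mulVec θ j) ∧ r = θ 0} ∧
      ∀ γ' : Fin k → ℝ, (∀ j, 0 ≤ γ' j) → W.transpose.mulVec γ' = e₁ →
        γ' ⬝ᵥ Y ≤ γ ⬝ᵥ Y := by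
  subst he₁
  have hne := exists_le_mulVec_of_pos_col W Y hW1
  obtain ⟨γ, hγ, hWγ, hle⟩ := exists_dual_feasible_ge hne fun θ hθ => csInf_le hbdd ⟨θ, hθ, rfl⟩
  have hweak : ∀ γ' : Fin k → ℝ, (∀ j, 0 ≤ γ' j) → Wᵀ *ᵥ γ' = Pi.single 0 1 → γ' ⬝ᵥ Y ≤
      sInf {r : ℝ | ∃ θ : Fin (p + 1) → ℝ, (∀ j, Y j ≤ W.mulVec θ j) ∧ r = θ 0} := by
    intro γ' hγ' hWγ'
    obtain ⟨θ, hθ⟩ := hne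
    refine le_csInf ⟨θ 0, θ, hθ, rfl⟩ ?_
    rintro _ ⟨θ', hθ', rfl⟩
    exact dotProduct_le_of_dual_feasible hγ' hWγ' hθ'
  exact ⟨γ, hγ, hWγ, (hweak γ hγ hWγ).antisymm hle, fun γ' hγ' hWγ' =>
    (hweak γ' hγ' hWγ').trans hle⟩
end

section
/- Suppose W_{j,1} > 0 for every j. Let γ be a dual feasible vector that is dual optimal, i.e. γ′ᵀY ≤ γᵀY for every dual feasible γ′. Suppose B := {j : γ_j > 0} has exactly p+1 elements and the rows {W_j : j ∈ B} are linearly independent. Then θ_B := W_B⁻¹ Y_B is an optimal solution of the primal LP, it satisfies Y_j = (W θ_B)_j for all j ∈ B, and the B-subvector of γ equals (W_Bᵀ)⁻¹e₁. (This is the solution part of the paper's Proposition A.1.) -/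
open Matrix

open Filter Topology in
/-- At a dual optimal point, no feasible direction improves the dual objective. -/
theorem dotProduct_nonpos_of_dual_optimal {m n : Type*} [Fintype m]
    (W : Matrix m n ℝ) (Y : m → ℝ) (e : n → ℝ) (γ : m → ℝ)
    (hγpos : ∀ j, 0 ≤ γ j) (hγW : Wᵀ *ᵥ γ = e)
    (hopt : ∀ γ' : m → ℝ, (∀ j, 0 ≤ γ' j) → Wᵀ *ᵥ γ' = e → γ' ⬝ᵥ Y ≤ γ ⬝ᵥ Y)
    (d : m → ℝ) (hdW : Wᵀ *ᵥ d = 0) (hd : ∀ j, γ j = 0 → 0 ≤ d j) :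
    d ⬝ᵥ Y ≤ 0 := by
  have hev : ∀ᶠ t : ℝ in 𝓝[>] 0, ∀ j, 0 ≤ γ j + t * d j := by
    refine eventually_all.2 fun j => ?_
    rcases (hγpos j).eq_or_lt with h | h
    · filter_upwards [self_mem_nhdsWithin] with t ht
      have := mul_nonneg (le_of_lt ht) (hd j h.symm)
      linarith
    · have hc : Tendsto (fun t : ℝ => γ j + t * d j) (𝓝 0) (𝓝 (γ j + 0 * d j)) :=
        Continuous.tendsto (by fun_prop) 0
      have hpos : 0 < γ j + 0 * d j := by linarith
      filter_upwards [nhdsWithin_le_nhds (hc.eventually (lt_mem_nhds hpos))] with t ht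
      exact ht.le
  obtain ⟨t, ht, htpos⟩ := (hev.and self_mem_nhdsWithin).exists
  have hle := hopt (γ + t • d) (by simpa using ht)
    (by rw [mulVec_add, mulVec_smul, hdW, hγW, smul_zero, add_zero])
  rw [add_dotProduct, smul_dotProduct, smul_eq_mul] at hle
  exact nonpos_of_mul_nonpos_right (by linarith) htpos

/-- Proposition A.1 (solution part): a dual optimal vertex with exactly `p + 1`
positive entries and linearly independent corresponding rows yields the primal
solution `θ_B = W_B⁻¹ Y_B` with the moments `B` binding. -/
theorem stmt_6
    (k p : ℕ) (hk : 0 < k)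
    (W : Matrix (Fin k) (Fin (p + 1)) ℝ) (Y : Fin k → ℝ)
    (e₁ : Fin (p + 1) → ℝ) (he₁ : e₁ = Pi.single 0 1)
    (hW1 : ∀ j, 0 < W j 0)
    (γ : Fin k → ℝ)
    (hγpos : ∀ j, 0 ≤ γ j) (hγW : W.transpose.mulVec γ = e₁)
    (hopt : ∀ γ' : Fin k → ℝ, (∀ j, 0 ≤ γ' j) → W.transpose.mulVec γ' = e₁ →
      γ' ⬝ᵥ Y ≤ γ ⬝ᵥ Y)
    (b : Fin (p + 1) → Fin k) (hb : Function.Injective b)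
    (hrange : Set.range b = {j | 0 < γ j})
    (hindep : LinearIndependent ℝ fun i : Fin (p + 1) => W (b i))
    (WB : Matrix (Fin (p + 1)) (Fin (p + 1)) ℝ) (hWBdef : WB = W.submatrix b id)
    (θB : Fin (p + 1) → ℝ) (hθB : θB = Matrix.mulVec (WB⁻¹) fun i => Y (b i)) :
    (∀ j, Y j ≤ W.mulVec θB j) ∧
    (∀ θ' : Fin (p + 1) → ℝ, (∀ j, Y j ≤ W.mulVec θ' j) → θB 0 ≤ θ' 0) ∧
    (∀ i, Y (b i) = W.mulVec θB (b i)) ∧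
    (∀ i, γ (b i) = Matrix.mulVec ((WB.transpose)⁻¹) e₁ i) := by
  have hzero : ∀ j, j ∉ Set.range b → γ j = 0 := fun j hj =>
    le_antisymm (not_lt.1 fun h => hj (hrange ▸ h)) (hγpos j)
  have hunit : IsUnit WB :=
    linearIndependent_rows_iff_isUnit.1 (by rw [hWBdef]; exact hindep)
  have hdet : IsUnit WB.det := (isUnit_iff_isUnit_det _).1 hunit
  have hdetT : IsUnit WBᵀ.det := by rwa [det_transpose]
  have hsolve : WB *ᵥ θB = fun i => Y (b i) := by
    rw [hθB, mulVec_mulVec, mul_nonsing_inv _ hdet, one_mulVec]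
  have hbind : ∀ i, Y (b i) = (W *ᵥ θB) (b i) := fun i => by
    rw [← congrFun hsolve i, hWBdef]
    rfl
  refine ⟨fun j₀ => ?_, fun θ' hθ' => ?_, hbind, fun i => ?_⟩
  · obtain ⟨c, hc⟩ : ∃ c, WBᵀ *ᵥ c = W j₀ :=
      ⟨WBᵀ⁻¹ *ᵥ W j₀, by rw [mulVec_mulVec, mul_nonsing_inv _ hdetT, one_mulVec]⟩
    have hrow : W j₀ = ∑ i, c i • W (b i) := by
      rw [← hc, mulVec_transpose, hWBdef]
      ext l
      simp [vecMul, dotProduct]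
    have hdir := dotProduct_nonpos_of_dual_optimal W Y e₁ γ hγpos hγW hopt
      (Pi.single j₀ 1 - ∑ i, c i • Pi.single (b i) 1)
      (by
        rw [mulVec_transpose, sub_vecMul, sum_vecMul]
        simp only [smul_vecMul, single_one_vecMul, row]
        rw [← hrow, sub_self])
      (fun j hj => by
        have hne : ∀ i, j ≠ b i := fun i hi => by
          have : b i ∈ {j | 0 < γ j} := hrange ▸ Set.mem_range_self i
          exact absurd (hi ▸ hj) (ne_of_gt this)
        have hs : (0 : ℝ) ≤ (Pi.single j₀ 1 : Fin k → ℝ) j := by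
          by_cases h : j = j₀ <;> simp [h]
        simpa [Finset.sum_apply, Pi.single_apply, hne] using hs)
    have hval : (W *ᵥ θB) j₀ = ∑ i, c i * Y (b i) := by
      change W j₀ ⬝ᵥ θB = _
      rw [hrow, sum_dotProduct]
      refine Finset.sum_congr rfl fun i _ => ?_
      rw [smul_dotProduct, smul_eq_mul, hbind i]
      rfl
    rw [sub_dotProduct, sum_dotProduct] at hdir
    simp only [smul_dotProduct, single_one_dotProduct, smul_eq_mul] at hdir
    linarith
  · have hfirst : ∀ θ : Fin (p + 1) → ℝ, θ 0 = γ ⬝ᵥ W *ᵥ θ := fun θ => by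
      rw [dotProduct_mulVec, ← mulVec_transpose, hγW, he₁, single_one_dotProduct]
    rw [hfirst θB, hfirst θ']
    refine Finset.sum_le_sum fun j _ => ?_
    by_cases hj : j ∈ Set.range b
    · obtain ⟨i, rfl⟩ := hj
      rw [← hbind i]
      exact mul_le_mul_of_nonneg_left (hθ' _) (hγpos _)
    · simp [hzero j hj]
  · have hγB : WBᵀ *ᵥ (fun i => γ (b i)) = e₁ := by
      rw [← hγW, hWBdef]
      ext l
      exact Fintype.sum_of_injective b hb _ _ (fun j hj => by simp [hzero j hj]) fun _ => rfl
    rw [← hγB, mulVec_mulVec, nonsing_inv_mul _ hdetT, one_mulVec]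
end

section
/- Suppose θ̂ is the unique optimal solution of the primal LP (θ̂ ∈ 𝓕 and every θ ∈ 𝓕 with θ ≠ θ̂ satisfies θ̂₀ < θ₀), let B := {j : Y_j = (Wθ̂)_j} be the binding set, and assume the rows {W_j : j ∈ B} are linearly independent. Then every dual optimal vector γ — i.e. every γ with γ ≥ 0 componentwise, Wᵀγ = e₁, and γᵀY = θ̂₀ — satisfies {j : γ_j > 0} = B; in particular γ has exactly p+1 strictly positive entries and the rows of W corresponding to these entries are linearly independent. (This is the paper's Lemma A.3.) -/
open Matrix

/-- A direction along which no binding constraint decreases stays feasible for a short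
positive time. -/
lemma exists_pos_feasible_step {ι κ : Type*} [Finite κ] [Fintype ι]
    (W : Matrix κ ι ℝ) (Y : κ → ℝ) (θ d : ι → ℝ) (hfeas : ∀ j, Y j ≤ (W *ᵥ θ) j)
    (hd : ∀ j, Y j = (W *ᵥ θ) j → 0 ≤ (W *ᵥ d) j) :
    ∃ t : ℝ, 0 < t ∧ ∀ j, Y j ≤ (W *ᵥ (θ + t • d)) j := by
  have h : ∀ᶠ t : ℝ in nhdsWithin 0 (Set.Ioi 0),
      0 < t ∧ ∀ j, Y j ≤ (W *ᵥ (θ + t • d)) j := by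
    refine Filter.Eventually.and self_mem_nhdsWithin (Filter.eventually_all.2 fun j => ?_)
    simp only [mulVec_add, mulVec_smul, Pi.add_apply, Pi.smul_apply, smul_eq_mul]
    rcases (hfeas j).eq_or_lt with hj | hj
    · filter_upwards [self_mem_nhdsWithin] with t ht
      have := mul_nonneg (le_of_lt ht) (hd j hj)
      linarith
    · have hc : Continuous fun t : ℝ => (W *ᵥ θ) j + t * (W *ᵥ d) j := by fun_prop
      have := (hc.tendsto 0).eventually_const_lt (u := Y j) (by simpa using hj)
      exact nhdsWithin_le_nhds (this.mono fun t ht => ht.le)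
  exact h.exists

/-- Lemma A.3: with a unique non-degenerate primal solution, every dual optimal
vector has support exactly the binding set, hence exactly `p + 1` strictly positive
entries corresponding to linearly independent rows of `W`. -/
theorem stmt_7
    (k p : ℕ) (hk : 0 < k)
    (W : Matrix (Fin k) (Fin (p + 1)) ℝ) (Y : Fin k → ℝ)
    (e₁ : Fin (p + 1) → ℝ) (he₁ : e₁ = Pi.single 0 1)
    (θhat : Fin (p + 1) → ℝ)
    (hfeas : ∀ j, Y j ≤ W.mulVec θhat j)
    (hunique : ∀ θ : Fin (p + 1) → ℝ, (∀ j, Y j ≤ W.mulVec θ j) → θ ≠ θhat → θhat 0 < θ 0)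
    (B : Set (Fin k)) (hB : B = {j | Y j = W.mulVec θhat j})
    (hindep : LinearIndependent ℝ fun j : B => W (j : Fin k)) :
    ∀ γ : Fin k → ℝ, (∀ j, 0 ≤ γ j) → W.transpose.mulVec γ = e₁ → γ ⬝ᵥ Y = θhat 0 →
      {j | 0 < γ j} = B ∧
      Set.ncard {j | 0 < γ j} = p + 1 ∧
      LinearIndependent ℝ fun j : {j | 0 < γ j} => W (j : Fin k) := by
  classical
  intro γ hγ hW hY
  have hdir (d : Fin (p + 1) → ℝ) (hd : ∀ j ∈ B, 0 ≤ (W *ᵥ d) j) (hd0 : d ≠ 0) : 0 < d 0 := by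
    obtain ⟨t, ht, hft⟩ := exists_pos_feasible_step W Y θhat d hfeas
      fun j hj => hd j (by simpa [hB] using hj)
    have := hunique _ hft (by simp [ht.ne', hd0])
    simp only [Pi.add_apply, Pi.smul_apply, smul_eq_mul, lt_add_iff_pos_right] at this
    exact pos_of_mul_pos_right this ht.le
  have hdual (d : Fin (p + 1) → ℝ) : γ ⬝ᵥ W *ᵥ d = d 0 := by
    rw [dotProduct_mulVec, ← mulVec_transpose, hW, he₁, single_one_dotProduct]
  have hslack : ∀ j, γ j * ((W *ᵥ θhat) j - Y j) = 0 := by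
    have hsum : γ ⬝ᵥ (W *ᵥ θhat - Y) = 0 := by rw [dotProduct_sub, hdual, hY, sub_self]
    have := (Finset.sum_eq_zero_iff_of_nonneg fun j _ =>
      mul_nonneg (hγ j) (sub_nonneg.2 (hfeas j))).1 hsum
    exact fun j => this j (Finset.mem_univ j)
  have hzero (j : Fin k) (hj : j ∉ B) : γ j = 0 := by
    refine (mul_eq_zero.1 (hslack j)).resolve_right fun h => hj ?_
    rw [hB]
    exact (sub_eq_zero.1 h).symm
  let A : Matrix B (Fin (p + 1)) ℝ := W.submatrix Subtype.val id
  have hinj : Function.Injective A.mulVecLin := by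
    rw [injective_iff_map_eq_zero]
    intro d hd
    have hdB : ∀ j ∈ B, (W *ᵥ d) j = 0 := fun j hj => congrFun hd ⟨j, hj⟩
    by_contra hd0
    refine (hdir d (fun j hj => (hdB j hj).ge) hd0).ne' ?_
    rw [← hdual d]
    refine Finset.sum_eq_zero fun j _ => ?_
    by_cases hj : j ∈ B
    · rw [hdB j hj, mul_zero]
    · rw [hzero j hj, zero_mul]
  have hcard : Fintype.card B = p + 1 := by
    apply le_antisymm
    · simpa using hindep.fintype_card_le_finrank
    · simpa using LinearMap.finrank_le_finrank_of_injective hinj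
  have hsurj : Function.Surjective A.mulVecLin :=
    (LinearMap.injective_iff_surjective_of_finrank_eq_finrank (by simp [hcard])).1 hinj
  have hsupp : {j | 0 < γ j} = B := by
    ext j
    refine ⟨fun hj => by_contra fun h => (ne_of_gt hj) (hzero j h), fun hj => ?_⟩
    obtain ⟨d, hd⟩ := hsurj (Pi.single ⟨j, hj⟩ 1)
    have hdB (i : Fin k) (hi : i ∈ B) : (W *ᵥ d) i = if i = j then 1 else 0 := by
      have hi' : (W *ᵥ d) i = Pi.single (M := fun _ : B => ℝ) ⟨j, hj⟩ 1 ⟨i, hi⟩ :=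
        congrFun hd ⟨i, hi⟩
      simpa [Pi.single_apply] using hi'
    have hpos : 0 < d 0 := by
      refine hdir d (fun i hi => ?_) ?_
      · rw [hdB i hi]
        split_ifs <;> norm_num
      · rintro rfl
        simpa using hdB j hj
    have hval : γ ⬝ᵥ W *ᵥ d = γ j := by
      rw [dotProduct, Finset.sum_eq_single j]
      · simp [hdB j hj]
      · intro i _ hij
        by_cases hi : i ∈ B
        · simp [hdB i hi, hij]
        · simp [hzero i hi]
      · simp
    rwa [← hdual d, hval] at hpos
  rw [hsupp]
  exact ⟨rfl, by rw [← hcard, ← Nat.card_coe_set_eq, Nat.card_eq_fintype_card], hindep⟩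
end

section
/- Let k ≥ 2, α ∈ (0,1), and μ ∈ ℝ^k with μ_j ≤ 0 for all j. Let P_μ be the product probability measure on ℝ^k whose j-th marginal is the real Gaussian measure with mean μ_j and variance 1. For y ∈ ℝ^k let η̂(y) := max_j y_j, and let v(y) be the second-largest value of the coordinates of y, i.e. v(y) := max_{j ≠ ĵ(y)} y_j where ĵ(y) is the smallest index attaining the maximum. For v ∈ ℝ, let c_α(v) := sInf{c ∈ ℝ : Q_v(−∞, c] ≥ 1−α}, where Q_v is the standard real Gaussian measure conditioned on the event [v, ∞). Then P_μ{y : η̂(y) > c_α(v(y))} ≤ α, with equality when μ = 0. (This is the size-control property of the paper's conditional test in the case without nuisance parameters, Section 5.1.) -/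
open MeasureTheory ProbabilityTheory

open Set Filter Topology

lemma continuous_cdf (μ : Measure ℝ) [IsProbabilityMeasure μ] [NullSingletonClass μ] :
    Continuous (cdf μ) := by
  refine continuous_iff_continuousAt.2 fun x => continuousAt_iff_continuous_left_right.2 ⟨?_, ?_⟩
  · rw [← continuousWithinAt_Iio_iff_Iic, (cdf μ).mono.continuousWithinAt_Iio_iff_leftLim_eq]
    have h := (cdf μ).measure_singleton x
    rw [measure_cdf, measure_singleton, eq_comm, ENNReal.ofReal_eq_zero] at h
    exact le_antisymm ((cdf μ).mono.leftLim_le le_rfl) (by linarith)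
  · exact (cdf μ).right_continuous x

lemma strictMono_cdf (μ : Measure ℝ) [IsProbabilityMeasure μ] [μ.IsOpenPosMeasure] :
    StrictMono (cdf μ) := by
  intro a b hab
  have h : 0 < μ (Ioc a b) :=
    ((isOpen_Ioo.measure_pos μ (nonempty_Ioo.2 hab))).trans_le (measure_mono Ioo_subset_Ioc_self)
  rw [← measure_cdf μ, StieltjesFunction.measure_Ioc, ENNReal.ofReal_pos] at h
  linarith

lemma measure_Ioi_eq_ofReal_cdf (μ : Measure ℝ) [IsProbabilityMeasure μ] (x : ℝ) :
    μ (Ioi x) = ENNReal.ofReal (1 - cdf μ x) := by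
  conv_lhs => rw [← measure_cdf μ]
  exact (cdf μ).measure_Ioi (tendsto_cdf_atTop μ) x

/-- Every upper tail of an atomless law with full support can be shrunk by a factor `α`. -/
lemma exists_one_sub_cdf_eq (μ : Measure ℝ) [IsProbabilityMeasure μ] [NullSingletonClass μ]
    [μ.IsOpenPosMeasure] {α : ℝ} (hα : α ∈ Ioo (0 : ℝ) 1) (t : ℝ) :
    ∃ c, t < c ∧ 1 - cdf μ c = α * (1 - cdf μ t) := by
  have hs := strictMono_cdf μ
  have ht : cdf μ t < 1 := (hs (lt_add_one t)).trans_le (cdf_le_one μ _)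
  have hlt : 1 - α * (1 - cdf μ t) < 1 := by nlinarith [hα.1]
  obtain ⟨b, hb⟩ := ((tendsto_cdf_atTop μ).eventually (eventually_gt_nhds hlt)).exists
  obtain ⟨a, ha⟩ : ∃ a, cdf μ a ≤ 1 - α * (1 - cdf μ t) := ⟨t, by nlinarith [hα.2]⟩
  obtain ⟨c, hc⟩ := mem_range_of_exists_le_of_exists_ge (continuous_cdf μ) ⟨a, ha⟩ ⟨b, hb.le⟩
  refine ⟨c, hs.lt_iff_lt.1 ?_, by linarith⟩
  nlinarith [hα.2]

/-- The `(1 - α)`-quantile of the law `μ` truncated to `[t, ∞)`. -/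
lemma one_sub_cdf_sInf_cond_Ici (μ : Measure ℝ) [IsProbabilityMeasure μ] [NullSingletonClass μ]
    [μ.IsOpenPosMeasure] {α : ℝ} (hα : α ∈ Ioo (0 : ℝ) 1) (t : ℝ) :
    1 - cdf μ (sInf {c : ℝ | ENNReal.ofReal (1 - α) ≤ μ[|Ici t] (Iic c)}) =
      α * (1 - cdf μ t) := by
  have hs := strictMono_cdf μ
  have ht : 0 < 1 - cdf μ t := sub_pos.2 ((hs (lt_add_one t)).trans_le (cdf_le_one μ _))
  obtain ⟨q, -, hq⟩ := exists_one_sub_cdf_eq μ hα t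
  suffices {c : ℝ | ENNReal.ofReal (1 - α) ≤ μ[|Ici t] (Iic c)} = Ici q by
    rw [this, csInf_Ici, hq]
  ext c
  rw [mem_ofPred_eq, cond_apply measurableSet_Ici, Ici_inter_Iic, ← measure_congr Ioc_ae_eq_Icc,
    ← measure_congr Ioi_ae_eq_Ici, measure_Ioi_eq_ofReal_cdf, mul_comm, ← div_eq_mul_inv]
  conv_lhs => rw [← measure_cdf μ]
  rw [StieltjesFunction.measure_Ioc, measure_cdf,
    ← ENNReal.ofReal_div_of_pos ht, mem_Ici, ← hs.le_iff_le]
  by_cases hc : cdf μ c ≤ cdf μ t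
  · rw [ENNReal.ofReal_eq_zero.2 (div_nonpos_of_nonpos_of_nonneg (by linarith) ht.le)]
    simp only [nonpos_iff_eq_zero, ENNReal.ofReal_eq_zero]
    constructor <;> intro h <;> nlinarith [hα.2]
  · rw [ENNReal.ofReal_le_ofReal_iff (div_nonneg (by linarith) ht.le), le_div_iff₀ ht]
    constructor <;> intro h <;> linarith

instance (m : ℝ) : NullSingletonClass (gaussianReal m 1) :=
  nullSingletonClass_gaussianReal one_ne_zero

instance (m : ℝ) : (gaussianReal m 1).IsOpenPosMeasure :=
  (gaussianReal_absolutelyContinuous' m one_ne_zero).isOpenPosMeasure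

lemma gaussianPDFReal_eq_exp_mul (m x : ℝ) :
    gaussianPDFReal m 1 x = Real.exp (m * x - m ^ 2 / 2) * gaussianPDFReal 0 1 x := by
  simp only [gaussianPDFReal_def]
  rw [mul_left_comm, ← Real.exp_add]
  congr 2
  push_cast
  ring

lemma gaussianReal_real_eq_integral (m : ℝ) (s : Set ℝ) :
    (gaussianReal m 1).real s = ∫ x in s, gaussianPDFReal m 1 x := by
  rw [measureReal_def, gaussianReal_apply_eq_integral m one_ne_zero,
    ENNReal.toReal_ofReal (integral_nonneg fun x => gaussianPDFReal_nonneg _ _ _)]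

/-- Monotone likelihood ratio: shifting a Gaussian to the left makes its tails relatively lighter. -/
lemma gaussianReal_real_Ioi_mul_le {m : ℝ} (hm : m ≤ 0) (w c : ℝ) :
    (gaussianReal m 1).real (Ioi c) * (gaussianReal 0 1).real (Ioc w c) ≤
      (gaussianReal m 1).real (Ioc w c) * (gaussianReal 0 1).real (Ioi c) := by
  set L := Real.exp (m * c - m ^ 2 / 2)
  have hi (m : ℝ) (s : Set ℝ) : IntegrableOn (gaussianPDFReal m 1) s :=
    (integrable_gaussianPDFReal m 1).integrableOn
  have hu : (gaussianReal m 1).real (Ioi c) ≤ L * (gaussianReal 0 1).real (Ioi c) := by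
    rw [gaussianReal_real_eq_integral, gaussianReal_real_eq_integral, ← integral_const_mul]
    refine setIntegral_mono_on (hi m _) ((hi 0 _).const_mul L) measurableSet_Ioi fun x hx => ?_
    rw [gaussianPDFReal_eq_exp_mul]
    refine mul_le_mul_of_nonneg_right (Real.exp_le_exp.2 ?_) (gaussianPDFReal_nonneg _ _ _)
    nlinarith [mem_Ioi.1 hx]
  have hl : L * (gaussianReal 0 1).real (Ioc w c) ≤ (gaussianReal m 1).real (Ioc w c) := by
    rw [gaussianReal_real_eq_integral, gaussianReal_real_eq_integral, ← integral_const_mul]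
    refine setIntegral_mono_on ((hi 0 _).const_mul L) (hi m _) measurableSet_Ioc fun x hx => ?_
    rw [gaussianPDFReal_eq_exp_mul m]
    refine mul_le_mul_of_nonneg_right (Real.exp_le_exp.2 ?_) (gaussianPDFReal_nonneg _ _ _)
    nlinarith [hx.2]
  calc _ ≤ L * (gaussianReal 0 1).real (Ioi c) * (gaussianReal 0 1).real (Ioc w c) := by gcongr
    _ = L * (gaussianReal 0 1).real (Ioc w c) * (gaussianReal 0 1).real (Ioi c) := by ring
    _ ≤ _ := by gcongr

lemma setOf_one_sub_cdf_lt_eq_Ioi {μ : Measure ℝ} [IsProbabilityMeasure μ]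
    [μ.IsOpenPosMeasure] {a c : ℝ} (hc : 1 - cdf μ c = a) :
    {x | 1 - cdf μ x < a} = Ioi c := by
  ext x
  rw [mem_ofPred_eq, ← hc, sub_lt_sub_iff_left, (strictMono_cdf μ).lt_iff_lt, mem_Ioi]

lemma gaussianReal_zero_setOf_one_sub_cdf_lt {α : ℝ} (hα : α ∈ Ioo (0 : ℝ) 1) (w : ℝ) :
    gaussianReal 0 1 {x | 1 - cdf (gaussianReal 0 1) x < α * (1 - cdf (gaussianReal 0 1) w)} =
      ENNReal.ofReal α * gaussianReal 0 1 (Ioi w) := by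
  obtain ⟨c, -, hc⟩ := exists_one_sub_cdf_eq (gaussianReal 0 1) hα w
  rw [setOf_one_sub_cdf_lt_eq_Ioi hc, measure_Ioi_eq_ofReal_cdf, measure_Ioi_eq_ofReal_cdf, hc,
    ENNReal.ofReal_mul hα.1.le]

lemma gaussianReal_setOf_one_sub_cdf_lt_le {α : ℝ} (hα : α ∈ Ioo (0 : ℝ) 1) {m : ℝ} (hm : m ≤ 0)
    (w : ℝ) :
    gaussianReal m 1 {x | 1 - cdf (gaussianReal 0 1) x < α * (1 - cdf (gaussianReal 0 1) w)} ≤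
      ENNReal.ofReal α * gaussianReal m 1 (Ioi w) := by
  obtain ⟨c, hwc, hc⟩ := exists_one_sub_cdf_eq (gaussianReal 0 1) hα w
  have hsplit (m : ℝ) : (gaussianReal m 1).real (Ioi w) =
      (gaussianReal m 1).real (Ioc w c) + (gaussianReal m 1).real (Ioi c) := by
    rw [← Ioc_union_Ioi_eq_Ioi hwc.le,
      measureReal_union (Ioc_disjoint_Ioi le_rfl) measurableSet_Ioi]
  have htail : (gaussianReal 0 1).real (Ioi c) = α * (gaussianReal 0 1).real (Ioi w) := by
    have h := gaussianReal_zero_setOf_one_sub_cdf_lt hα w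
    rw [setOf_one_sub_cdf_lt_eq_Ioi hc] at h
    rw [measureReal_def, h, ENNReal.toReal_mul, ENNReal.toReal_ofReal hα.1.le, measureReal_def]
  have hpos : 0 < (gaussianReal 0 1).real (Ioi w) := by
    rw [measureReal_def]
    exact ENNReal.toReal_pos (isOpen_Ioi.measure_pos _ nonempty_Ioi).ne' (measure_ne_top _ _)
  have key := gaussianReal_real_Ioi_mul_le hm w c
  have h0 := hsplit 0
  have hIoc : (gaussianReal 0 1).real (Ioc w c) = (1 - α) * (gaussianReal 0 1).real (Ioi w) := by
    linarith
  rw [hIoc, htail] at key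
  have hle : (gaussianReal m 1).real (Ioi c) ≤ α * (gaussianReal m 1).real (Ioi w) := by
    rw [hsplit m]
    refine le_of_mul_le_mul_right ?_ hpos
    linarith
  rw [setOf_one_sub_cdf_lt_eq_Ioi hc]
  simpa [ENNReal.ofReal_mul hα.1.le, ofReal_measureReal] using ENNReal.ofReal_le_ofReal hle

lemma measure_pi_setOf_succAbove {n : ℕ} (ν : Fin (n + 1) → Measure ℝ)
    [∀ i, IsProbabilityMeasure (ν i)] (j : Fin (n + 1)) {r : ℝ → ℝ → Prop}
    (hr : MeasurableSet {p : ℝ × ℝ | r p.1 p.2}) :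
    Measure.pi ν {y | r (y j) (⨆ i, y (j.succAbove i))} =
      ∫⁻ z : Fin n → ℝ, ν j {x | r x (⨆ i, z i)} ∂(Measure.pi fun i => ν (j.succAbove i)) := by
  have hm : Measurable fun p : ℝ × (Fin n → ℝ) => (p.1, ⨆ i, p.2 i) := by
    refine measurable_fst.prodMk (Measurable.iSup fun i => ?_)
    fun_prop
  exact ((measurePreserving_piFinSuccAbove ν j).measure_preimage
    (hm hr).nullMeasurableSet).trans (Measure.prod_apply_symm (hm hr))

lemma lt_of_one_sub_cdf_lt {μ : Measure ℝ} [IsProbabilityMeasure μ] {α : ℝ}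
    (hα : α ∈ Ioo (0 : ℝ) 1) {x w : ℝ} (h : 1 - cdf μ x < α * (1 - cdf μ w)) : w < x := by
  refine (monotone_cdf μ).reflect_lt ?_
  nlinarith [hα.2, cdf_le_one μ w]

lemma measurableSet_one_sub_cdf_lt (μ : Measure ℝ) (α : ℝ) :
    MeasurableSet {p : ℝ × ℝ | 1 - cdf μ p.1 < α * (1 - cdf μ p.2)} := by
  have hF : Measurable (cdf μ) := (monotone_cdf μ).measurable
  exact measurableSet_lt (by fun_prop) (by fun_prop)

lemma disjoint_setOf_iSup_succAbove_lt {n : ℕ} :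
    Pairwise (Function.onFun Disjoint fun j : Fin (n + 1) =>
      {y : Fin (n + 1) → ℝ | ⨆ i, y (j.succAbove i) < y j}) := by
  have key {y : Fin (n + 1) → ℝ} {i j : Fin (n + 1)} (hij : i ≠ j)
      (h : ⨆ l, y (j.succAbove l) < y j) : y i < y j := by
    obtain ⟨l, rfl⟩ := Fin.exists_succAbove_eq hij
    exact (le_ciSup (f := fun l => y (j.succAbove l)) (Finite.bddAbove_range _) l).trans_lt h
  intro i j hij
  exact Set.disjoint_left.2 fun y hi hj => (key hij hj).asymm (key hij.symm hi)

lemma iUnion_setOf_iSup_succAbove_le {n : ℕ} [Nonempty (Fin n)] :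
    ⋃ j : Fin (n + 1), {y : Fin (n + 1) → ℝ | ⨆ i, y (j.succAbove i) ≤ y j} = univ := by
  refine eq_univ_of_forall fun y => ?_
  obtain ⟨j, hj⟩ := Finite.exists_max y
  exact mem_iUnion.2 ⟨j, ciSup_le fun i => hj _⟩

lemma measurableSet_setOf_iSup_succAbove {n : ℕ} (j : Fin (n + 1)) {r : ℝ → ℝ → Prop}
    (hr : MeasurableSet {p : ℝ × ℝ | r p.1 p.2}) :
    MeasurableSet {y : Fin (n + 1) → ℝ | r (y j) (⨆ i, y (j.succAbove i))} := by
  have hm : Measurable fun y : Fin (n + 1) → ℝ => (y j, ⨆ i, y (j.succAbove i)) :=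
    (measurable_pi_apply j).prodMk (Measurable.iSup fun i => measurable_pi_apply _)
  exact hm hr



/-- Size control of the conditional test without nuisance parameters (Section 5.1):
the test comparing the maximum of `k` independent unit-variance Gaussians to the
truncated-normal critical value, conditioning on the second-largest value, has
null rejection probability at most `α`, with equality at `μ = 0`. -/
theorem stmt_8
    (k : ℕ) (hk : 2 ≤ k)
    (α : ℝ) (hα : α ∈ Set.Ioo (0 : ℝ) 1)
    (μ : Fin k → ℝ) (hμ : ∀ j, μ j ≤ 0)
    (P : (Fin k → ℝ) → Measure (Fin k → ℝ))
    (hP : ∀ m : Fin k → ℝ, P m = Measure.pi fun j => gaussianReal (m j) 1)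
    (ηhat : (Fin k → ℝ) → ℝ)
    (hη : ∀ y, ηhat y = ⨆ j, y j)
    (jhat : (Fin k → ℝ) → Fin k)
    (hjhat : ∀ y, (∀ j, y j ≤ y (jhat y)) ∧ ∀ j, (∀ i, y i ≤ y j) → jhat y ≤ j)
    (v : (Fin k → ℝ) → ℝ)
    (hv : ∀ y, v y = ⨆ j : {j : Fin k // j ≠ jhat y}, y j)
    (cα : ℝ → ℝ)
    (hcα : ∀ t : ℝ, cα t =
      sInf {c : ℝ | ENNReal.ofReal (1 - α) ≤ (gaussianReal 0 1)[|Set.Ici t] (Set.Iic c)}) :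
    P μ {y | cα (v y) < ηhat y} ≤ ENNReal.ofReal α ∧
      (μ = 0 → P μ {y | cα (v y) < ηhat y} = ENNReal.ofReal α) := by
  obtain ⟨n, rfl⟩ : ∃ n, k = n + 1 := ⟨k - 1, by omega⟩
  have : Nonempty (Fin n) := ⟨⟨0, by omega⟩⟩
  rw [hP]
  set F := cdf (gaussianReal 0 1)
  let E (j : Fin (n + 1)) : Set (Fin (n + 1) → ℝ) :=
    {y | 1 - F (y j) < α * (1 - F (⨆ i, y (j.succAbove i)))}
  let A (j : Fin (n + 1)) : Set (Fin (n + 1) → ℝ) := {y | ⨆ i, y (j.succAbove i) < y j}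
  have hEA (j) : E j ⊆ A j := fun y hy => lt_of_one_sub_cdf_lt hα hy
  have hevent : {y | cα (v y) < ηhat y} = ⋃ j, E j := by
    have hmem (y : Fin (n + 1) → ℝ) : cα (v y) < ηhat y ↔ y ∈ E (jhat y) := by
      have hmax : ηhat y = y (jhat y) := by
        rw [hη]
        exact le_antisymm (ciSup_le (hjhat y).1) (le_ciSup (Finite.bddAbove_range y) _)
      have hsnd : v y = ⨆ i, y ((jhat y).succAbove i) := by
        rw [hv]
        exact ((finSuccAboveEquiv (jhat y)).iSup_comp
          (g := fun j : {j : Fin (n + 1) // j ≠ jhat y} => y j)).symm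
      have hc := one_sub_cdf_sInf_cond_Ici (gaussianReal 0 1) hα (v y)
      rw [← hcα] at hc
      change _ ↔ 1 - F (y (jhat y)) < α * (1 - F _)
      rw [← hsnd, ← hmax, ← hc, sub_lt_sub_iff_left, (strictMono_cdf _).lt_iff_lt]
    ext y
    rw [mem_ofPred_eq, hmem, mem_iUnion]
    refine ⟨fun h => ⟨_, h⟩, fun ⟨j, hj⟩ => ?_⟩
    suffices jhat y = j by rwa [this]
    by_contra hne
    obtain ⟨l, hl⟩ := Fin.exists_succAbove_eq hne
    have h1 := le_ciSup (f := fun l => y (j.succAbove l)) (Finite.bddAbove_range _) l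
    simp only [hl] at h1
    exact absurd ((hjhat y).1 j) (not_le.2 (h1.trans_lt (hEA j hj)))
  have hEmeas (j) : MeasurableSet (E j) :=
    measurableSet_setOf_iSup_succAbove (r := fun x w => 1 - F x < α * (1 - F w)) j
      (measurableSet_one_sub_cdf_lt _ α)
  have hlt : MeasurableSet {p : ℝ × ℝ | p.2 < p.1} :=
    measurableSet_lt measurable_snd measurable_fst
  have hle : MeasurableSet {p : ℝ × ℝ | p.2 ≤ p.1} :=
    measurableSet_le measurable_snd measurable_fst
  have hAmeas (j) : MeasurableSet (A j) :=
    measurableSet_setOf_iSup_succAbove (r := fun x w => w < x) j hlt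
  have hE (j) := measure_pi_setOf_succAbove (r := fun x w => 1 - F x < α * (1 - F w))
    (fun j => gaussianReal (μ j) 1) j
    (measurableSet_one_sub_cdf_lt (gaussianReal 0 1) α)
  have hA (j) := measure_pi_setOf_succAbove (r := fun x w => w < x)
    (fun j => gaussianReal (μ j) 1) j hlt
  have hA' (j) := measure_pi_setOf_succAbove (r := fun x w => w ≤ x)
    (fun j => gaussianReal (μ j) 1) j hle
  set P' := Measure.pi fun j => gaussianReal (μ j) 1
  have hsum : P' (⋃ j, E j) = ∑ j, P' (E j) := by
    rw [measure_iUnion (fun i j hij => (disjoint_setOf_iSup_succAbove_lt hij).mono (hEA i) (hEA j))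
      hEmeas, tsum_fintype]
  have hsumA : ∑ j, P' (A j) = 1 := by
    refine le_antisymm ?_ ?_
    · rw [← tsum_fintype (L := .unconditional _),
        ← measure_iUnion disjoint_setOf_iSup_succAbove_lt hAmeas]
      exact prob_le_one
    · calc 1 = P' (⋃ j : Fin (n + 1), {y | ⨆ i, y (j.succAbove i) ≤ y j}) := by
            rw [iUnion_setOf_iSup_succAbove_le, measure_univ]
        _ ≤ ∑ j : Fin (n + 1), P' {y | ⨆ i, y (j.succAbove i) ≤ y j} :=
            measure_iUnion_fintype_le _ _
        _ = ∑ j, P' (A j) := Finset.sum_congr rfl fun j _ => by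
            rw [hA' j, hA j]
            exact lintegral_congr fun z => (measure_congr Ioi_ae_eq_Ici).symm
  rw [hevent, hsum]
  constructor
  · calc ∑ j, P' (E j) ≤ ∑ j, ENNReal.ofReal α * P' (A j) := by
          refine Finset.sum_le_sum fun j _ => ?_
          rw [hE j, hA j, ← lintegral_const_mul' _ _ ENNReal.ofReal_ne_top]
          exact lintegral_mono fun z => gaussianReal_setOf_one_sub_cdf_lt_le hα (hμ j) _
      _ = ENNReal.ofReal α := by rw [← Finset.mul_sum, hsumA, mul_one]
  · intro hμ0
    calc ∑ j, P' (E j) = ∑ j, ENNReal.ofReal α * P' (A j) := by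
          refine Finset.sum_congr rfl fun j _ => ?_
          rw [hE j, hA j, ← lintegral_const_mul' _ _ ENNReal.ofReal_ne_top]
          refine lintegral_congr fun z => ?_
          rw [hμ0]
          exact gaussianReal_zero_setOf_one_sub_cdf_lt hα _
      _ = ENNReal.ofReal α := by rw [← Finset.mul_sum, hsumA, mul_one]
end

section
/- Let θ̂ be an optimal solution of the primal LP, and let B := {j : Y_j = (Wθ̂)_j} be its binding set. Assume |B| = p+1 and W_B is invertible. Then all coordinates of (W_Bᵀ)⁻¹e₁ are nonnegative; equivalently, the vector γ ∈ ℝ^k with γ_j = 0 for j ∉ B and B-subvector (W_Bᵀ)⁻¹e₁ is dual feasible (γ ≥ 0 and Wᵀγ = e₁). (This is the paper's asserted claim, following Lemma 6, that γ_{n,B} satisfies W_nᵀγ_{n,B} = e₁ and γ_{n,B} ≥ 0 for any set of binding moments B at an optimum.) -/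
open Matrix

/-- If `θ` minimizes the coordinate `i₀` over a polyhedron, this coordinate does not
decrease along any direction that is feasible for the constraints binding at `θ`. -/
theorem nonneg_of_forall_binding_nonneg {ι κ : Type*} [Finite κ] [Fintype ι]
    {W : Matrix κ ι ℝ} {Y : κ → ℝ} {θ d : ι → ℝ} {i₀ : ι}
    (hfeas : ∀ j, Y j ≤ (W *ᵥ θ) j)
    (hopt : ∀ η : ι → ℝ, (∀ j, Y j ≤ (W *ᵥ η) j) → θ i₀ ≤ η i₀)
    (hd : ∀ j, Y j = (W *ᵥ θ) j → 0 ≤ (W *ᵥ d) j) : 0 ≤ d i₀ := by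
  have hev : ∀ᶠ t : ℝ in nhdsWithin 0 (Set.Ioi 0), ∀ j, Y j ≤ (W *ᵥ θ) j + t * (W *ᵥ d) j := by
    refine Filter.eventually_all.2 fun j => ?_
    rcases (hfeas j).eq_or_lt with h | h
    · filter_upwards [self_mem_nhdsWithin] with t ht
      exact h.le.trans (le_add_of_nonneg_right (mul_nonneg (le_of_lt ht) (hd j h)))
    · have hc : Continuous fun t : ℝ => (W *ᵥ θ) j + t * (W *ᵥ d) j := by fun_prop
      have hlt := (hc.tendsto 0).eventually_const_lt (u := Y j) (by simpa using h)
      exact (hlt.filter_mono nhdsWithin_le_nhds).mono fun t ht => ht.le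
  obtain ⟨t, ht, htpos⟩ := (hev.and self_mem_nhdsWithin).exists
  have h := hopt (θ + t • d) fun j => by
    simpa [Matrix.mulVec_add, Matrix.mulVec_smul] using ht j
  have h' : 0 ≤ t * d i₀ := by simpa using h
  exact nonneg_of_mul_nonneg_right h' htpos

/-- At an optimum with binding set `B`, `|B| = p + 1` and `W_B` invertible, the
vector `γ_B = (W_Bᵀ)⁻¹ e₁`, extended by zeros, is dual feasible. -/
theorem stmt_14
    (k p : ℕ) (hk : 0 < k)
    (W : Matrix (Fin k) (Fin (p + 1)) ℝ) (Y : Fin k → ℝ)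
    (e₁ : Fin (p + 1) → ℝ) (he₁ : e₁ = Pi.single 0 1)
    (θhat : Fin (p + 1) → ℝ)
    (hfeas : ∀ j, Y j ≤ W.mulVec θhat j)
    (hopt : ∀ θ : Fin (p + 1) → ℝ, (∀ j, Y j ≤ W.mulVec θ j) → θhat 0 ≤ θ 0)
    (b : Fin (p + 1) → Fin k) (hb : Function.Injective b)
    (hrange : Set.range b = {j | Y j = W.mulVec θhat j})
    (WB : Matrix (Fin (p + 1)) (Fin (p + 1)) ℝ) (hWBdef : WB = W.submatrix b id)
    (hWB : IsUnit WB.det) :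
    (∀ i, 0 ≤ Matrix.mulVec ((WB.transpose)⁻¹) e₁ i) ∧
    ∃ γ : Fin k → ℝ,
      (∀ j, j ∉ Set.range b → γ j = 0) ∧
      (∀ i, γ (b i) = Matrix.mulVec ((WB.transpose)⁻¹) e₁ i) ∧
      (∀ j, 0 ≤ γ j) ∧ W.transpose.mulVec γ = e₁ := by
  subst he₁ hWBdef
  have hnonneg : ∀ i, 0 ≤ (((W.submatrix b id)ᵀ)⁻¹ *ᵥ Pi.single 0 1) i := by
    intro i
    have hd : W.submatrix b id *ᵥ ((W.submatrix b id)⁻¹ *ᵥ Pi.single i 1) = Pi.single i 1 := by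
      rw [Matrix.mulVec_mulVec, Matrix.mul_nonsing_inv _ hWB, Matrix.one_mulVec]
    have h : 0 ≤ ((W.submatrix b id)⁻¹ *ᵥ Pi.single i 1) 0 := by
      refine nonneg_of_forall_binding_nonneg hfeas hopt fun j hj => ?_
      obtain ⟨l, rfl⟩ : j ∈ Set.range b := hrange ▸ hj
      have hl : (W *ᵥ ((W.submatrix b id)⁻¹ *ᵥ Pi.single i 1)) (b l)
          = (Pi.single i 1 : Fin (p + 1) → ℝ) l := congrFun hd l
      rw [hl]
      exact (Pi.single_nonneg.2 zero_le_one : (0 : Fin (p + 1) → ℝ) ≤ Pi.single i 1) l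
    rw [← Matrix.transpose_nonsing_inv]
    simpa using h
  refine ⟨hnonneg, Function.extend b (((W.submatrix b id)ᵀ)⁻¹ *ᵥ Pi.single 0 1) 0,
    fun j hj => Function.extend_apply' _ _ _ hj, fun i => hb.extend_apply _ _ i, fun j => ?_, ?_⟩
  · by_cases hj : j ∈ Set.range b
    · obtain ⟨i, rfl⟩ := hj
      rw [hb.extend_apply]
      exact hnonneg i
    · rw [Function.extend_apply' _ _ _ hj]
      rfl
  · have hdual : (W.submatrix b id)ᵀ *ᵥ (((W.submatrix b id)ᵀ)⁻¹ *ᵥ Pi.single 0 1)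
        = Pi.single 0 1 := by
      rw [Matrix.mulVec_mulVec, Matrix.mul_nonsing_inv _ (by rwa [Matrix.det_transpose]),
        Matrix.one_mulVec]
    refine Eq.trans (funext fun l => ?_) hdual
    refine (Fintype.sum_of_injective b hb _ _ (fun j hj => ?_) fun i => ?_).symm
    · rw [Function.extend_apply' _ _ _ hj]
      exact mul_zero _
    · rw [hb.extend_apply]
      rfl
end

section
/- Let F ⊆ ℝ^k be nonempty, and let s, w ∈ ℝ^k. Assume (i) for every c ∈ ℝ the set {γᵀ(s + c·w) : γ ∈ F} is bounded above, and (ii) there exists γ₀ ∈ F with γ₀ᵀw = 1 and γ₀ᵀs = 0. Then the set C := {c ∈ ℝ : c = sSup{γᵀ(s + c·w) : γ ∈ F}} is convex. (This is the paper's claim that the set of fixed points defining 𝒱^lo and 𝒱^up in the dual conditioning approach is convex, justifying the bisection algorithm.) -/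
open Matrix

/-- The set of fixed points defining `𝒱^lo` and `𝒱^up` in the dual conditioning
approach is convex. -/
theorem stmt_15
    (k : ℕ) (hk : 0 < k)
    (F : Set (Fin k → ℝ)) (hF : F.Nonempty)
    (s w : Fin k → ℝ)
    (hbdd : ∀ c : ℝ, BddAbove ((fun γ => γ ⬝ᵥ (s + c • w)) '' F))
    (hexist : ∃ γ₀ ∈ F, γ₀ ⬝ᵥ w = 1 ∧ γ₀ ⬝ᵥ s = 0) :
    Convex ℝ {c : ℝ | c = sSup ((fun γ => γ ⬝ᵥ (s + c • w)) '' F)} := by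
  intro x hx y hy a b ha hb hab
  simp only [Set.mem_ofPred_eq] at hx hy ⊢
  have value_le : ∀ c : ℝ, c = sSup ((fun γ => γ ⬝ᵥ (s + c • w)) '' F) →
      ∀ γ ∈ F, γ ⬝ᵥ s + c * (γ ⬝ᵥ w) ≤ c := by
    intro c hc γ hγ
    have h := le_csSup (hbdd c) (Set.mem_image_of_mem _ hγ)
    rw [← hc] at h
    simpa only [dotProduct_add, dotProduct_smul, smul_eq_mul] using h
  apply le_antisymm
  · obtain ⟨γ₀, hγ₀, hw, hs⟩ := hexist
    refine le_csSup (hbdd _) ⟨γ₀, hγ₀, ?_⟩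
    simp only [dotProduct_add, dotProduct_smul, smul_eq_mul, hw, hs, zero_add, mul_one]
  · refine csSup_le (hF.image _) ?_
    rintro _ ⟨γ, hγ, rfl⟩
    simp only [dotProduct_add, dotProduct_smul, smul_eq_mul]
    calc γ ⬝ᵥ s + (a * x + b * y) * (γ ⬝ᵥ w)
        = a * (γ ⬝ᵥ s + x * (γ ⬝ᵥ w)) + b * (γ ⬝ᵥ s + y * (γ ⬝ᵥ w)) := by
          linear_combination -(γ ⬝ᵥ s) * hab
      _ ≤ a * x + b * y := by
          gcongr
          · exact value_le x hx γ hγ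
          · exact value_le y hy γ hγ
end

section
/- Assume that for every δ ∈ ℝ^p some coordinate of Xδ is nonnegative (equivalently, inf_δ max_j (Xδ)_j ≠ −∞). Then for every ξ ∈ ℝ^k: min_{1≤j≤k} ξ_j/σ_j ≤ ⨅_{δ ∈ ℝ^p} max_{1≤j≤k} (ξ_j − (Xδ)_j)/σ_j ≤ max_{1≤j≤k} ξ_j/σ_j. (These are the boundedness inequalities for the profiled max statistic established in the paper's Lemma C.4.) -/
open Matrix

/-- Boundedness inequalities for the profiled max statistic (Lemma C.4). -/
theorem stmt_16
    (k p : ℕ) (hk : 0 < k)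
    (X : Matrix (Fin k) (Fin p) ℝ)
    (σ : Fin k → ℝ) (hσ : ∀ j, 0 < σ j)
    (hX : ∀ δ : Fin p → ℝ, ∃ j, 0 ≤ X.mulVec δ j) :
    ∀ ξ : Fin k → ℝ,
      (⨅ j, ξ j / σ j) ≤ (⨅ δ : Fin p → ℝ, ⨆ j, (ξ j - X.mulVec δ j) / σ j) ∧
      (⨅ δ : Fin p → ℝ, ⨆ j, (ξ j - X.mulVec δ j) / σ j) ≤ ⨆ j, ξ j / σ j := by
  intro ξ
  have lower : ∀ δ : Fin p → ℝ, (⨅ j, ξ j / σ j) ≤ ⨆ j, (ξ j - X.mulVec δ j) / σ j := by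
    intro δ
    obtain ⟨j, hj⟩ := hX (-δ)
    rw [Matrix.mulVec_neg, Pi.neg_apply] at hj
    calc (⨅ j, ξ j / σ j) ≤ ξ j / σ j := ciInf_le (Set.finite_range _).bddBelow j
      _ ≤ (ξ j - X.mulVec δ j) / σ j :=
        div_le_div_of_nonneg_right (by linarith) (hσ j).le
      _ ≤ _ := le_ciSup (f := fun j => (ξ j - X.mulVec δ j) / σ j)
        (Set.finite_range _).bddAbove j
  refine ⟨le_ciInf lower, ?_⟩
  refine (ciInf_le ⟨_, Set.forall_mem_range.2 lower⟩ 0).trans_eq ?_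
  simp
end
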